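/- Let S be a weak left order in a regular semigroup Q such that, in every D-class of Q, the R-classes contained in it form a chain under the order induced by ≤_R which is inversely well ordered (every non-empty subset has a greatest element). Then S is a straight weak left order in Q. -/

import Mathlib

universe u

variable {Q : Type u}

/-- `p ≤_L q` in a semigroup `Q`: `Q¹p ⊆ Q¹q`, i.e. `p = q` or `p = x*q` for some `x`. -/
def leL [Semigroup Q] (p q : Q) : Prop := p = q ∨ ∃ x, p = x * q

/-- `p ≤_R q` in a semigroup `Q`: `pQ¹ ⊆ qQ¹`. -/
def leR [Semigroup Q] (p q : Q) : Prop := p = q ∨ ∃ x, p = q * x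

/-- Green's relation `L`. -/
def GreenL [Semigroup Q] (p q : Q) : Prop := leL p q ∧ leL q p

/-- Green's relation `R`. -/
def GreenR [Semigroup Q] (p q : Q) : Prop := leR p q ∧ leR q p

/-- Green's relation `H = L ∩ R`. -/
def GreenH [Semigroup Q] (p q : Q) : Prop := GreenL p q ∧ GreenR p q

/-- Green's relation `D = L ∘ R`. -/
def GreenD [Semigroup Q] (p q : Q) : Prop := ∃ c, GreenL p c ∧ GreenR c q

/-- `h` is the group inverse `q♯` of `q` (in the group `H`-class of `q`):
`q` and `h` commute, `qhq = q` and `hqh = h`.  This holds precisely when `q` lies in a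
subgroup of `Q` and `h` is its group inverse there. -/
def IsGroupInverse [Semigroup Q] (q h : Q) : Prop :=
  q * h = h * q ∧ q * h * q = q ∧ h * q * h = h

/-- `q` lies in a subgroup of `Q` (i.e. `q ∈ H(Q)`, the `H`-class of `q` is a group). -/
def inSubgroup [Semigroup Q] (q : Q) : Prop := ∃ h, IsGroupInverse q h

/-- A semigroup is regular if every element `q` can be written `q = qxq`. -/
def Regular (Q : Type u) [Semigroup Q] : Prop := ∀ q : Q, ∃ x, q * x * q = q

/-- `S` is a weak left order in `Q`: every element of `Q` is `a♯ * b` with `a, b ∈ S`. -/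
def IsWeakLeftOrder [Semigroup Q] (S : Set Q) : Prop :=
  ∀ q : Q, ∃ a ∈ S, ∃ b ∈ S, ∃ c, IsGroupInverse a c ∧ q = c * b

/-- `S` is a straight weak left order in `Q`: every element of `Q` is `a♯ * b` with
`a, b ∈ S` and `a R b` in `Q`. -/
def IsStraightWeakLeftOrder [Semigroup Q] (S : Set Q) : Prop :=
  ∀ q : Q, ∃ a ∈ S, ∃ b ∈ S, (∃ c, IsGroupInverse a c ∧ q = c * b) ∧ GreenR a b

/-- `S` is a weak right order in `Q`: every element of `Q` is `b * a♯` with `a, b ∈ S`. -/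
def IsWeakRightOrder [Semigroup Q] (S : Set Q) : Prop :=
  ∀ q : Q, ∃ a ∈ S, ∃ b ∈ S, ∃ c, IsGroupInverse a c ∧ q = b * c

/-- `S` is a straight weak right order in `Q`: every element of `Q` is `b * a♯` with
`a, b ∈ S` and `a L b` in `Q`. -/
def IsStraightWeakRightOrder [Semigroup Q] (S : Set Q) : Prop :=
  ∀ q : Q, ∃ a ∈ S, ∃ b ∈ S, (∃ c, IsGroupInverse a c ∧ q = b * c) ∧ GreenL a b

/-- `S` is very large in `Q`: it meets every `H`-class of `Q`. -/
def VeryLarge [Semigroup Q] (S : Set Q) : Prop := ∀ q : Q, ∃ s ∈ S, GreenH s q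

/-- `S` is a local left order in `Q`: for every group `H`-class (the `H`-class of an
element `e` lying in a subgroup), every element of that `H`-class is `a⁻¹ * b` for some
`a, b ∈ S` lying in that `H`-class, `a⁻¹` being the group inverse of `a`. -/
def IsLocalLeftOrder [Semigroup Q] (S : Set Q) : Prop :=
  ∀ e : Q, inSubgroup e → ∀ q : Q, GreenH q e →
    ∃ a ∈ S, ∃ b ∈ S, GreenH a e ∧ GreenH b e ∧ ∃ c, IsGroupInverse a c ∧ q = c * b

theorem leR_refl [Semigroup Q] (a : Q) : leR a a := Or.inl rfl

theorem leR_trans [Semigroup Q] {a b c : Q} (h1 : leR a b) (h2 : leR b c) : leR a c := by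
  rcases h1 with rfl | ⟨x, rfl⟩
  · exact h2
  · rcases h2 with rfl | ⟨y, rfl⟩
    · exact Or.inr ⟨x, rfl⟩
    · exact Or.inr ⟨y * x, mul_assoc _ _ _⟩

/-- The setoid of Green's relation `R` on `Q`; its quotient is the set of `R`-classes. -/
def rSetoid (Q : Type u) [Semigroup Q] : Setoid Q :=
  ⟨GreenR, ⟨fun _ => ⟨Or.inl rfl, Or.inl rfl⟩, fun h => ⟨h.2, h.1⟩,
    fun h1 h2 => ⟨leR_trans h1.1 h2.1, leR_trans h2.2 h1.2⟩⟩⟩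

/-- The set of `R`-classes of `Q`. -/
def RClasses (Q : Type u) [Semigroup Q] := Quotient (rSetoid Q)

/-- The `R`-class of an element. -/
def RClassOf [Semigroup Q] (b : Q) : RClasses Q := Quotient.mk (rSetoid Q) b

/-- The partial order on `R`-classes induced by `≤_R`. -/
instance RClasses.instPartialOrder [Semigroup Q] : PartialOrder (RClasses Q) where
  le := Quotient.lift₂ leR (fun _ _ _ _ ha hb => propext
    ⟨fun h => leR_trans (leR_trans ha.2 h) hb.1, fun h => leR_trans (leR_trans ha.1 h) hb.2⟩)
  le_refl := by
    intro x; induction x using Quotient.ind; exact Or.inl rfl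
  le_trans := by
    intro x y z
    induction x using Quotient.ind; induction y using Quotient.ind; induction z using Quotient.ind
    exact leR_trans
  le_antisymm := by
    intro x y
    induction x using Quotient.ind; induction y using Quotient.ind
    intro h1 h2; exact Quotient.sound ⟨h1, h2⟩

/-- For `a, q ∈ Q`, `ρ(a,q)` is the set of `R`-classes `{ R_b : b D q and b ≤_R a }`,
partially ordered by the order induced by `≤_R`. -/
def rho [Semigroup Q] (a q : Q) : Set (RClasses Q) :=
  { x | ∃ b : Q, x = RClassOf b ∧ GreenD b q ∧ leR b a }

/-- The set of `R`-classes contained in the `D`-class of `q`. -/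
def DClassRClasses [Semigroup Q] (q : Q) : Set (RClasses Q) :=
  { x | ∃ b : Q, x = RClassOf b ∧ GreenD b q }

theorem leL_trans [Semigroup Q] {a b c : Q} (h1 : leL a b) (h2 : leL b c) : leL a c := by
  rcases h1 with rfl | ⟨x, rfl⟩
  · exact h2
  · rcases h2 with rfl | ⟨y, rfl⟩
    · exact Or.inr ⟨x, rfl⟩
    · exact Or.inr ⟨x * y, (mul_assoc _ _ _).symm⟩

theorem leR_mul_left [Semigroup Q] {u v : Q} (c : Q) (h : leR u v) : leR (c * u) (c * v) := by
  rcases h with rfl | ⟨x, rfl⟩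
  · exact leR_refl _
  · exact Or.inr ⟨x, (mul_assoc _ _ _).symm⟩

theorem IsGroupInverse.symm [Semigroup Q] {a c : Q} (h : IsGroupInverse a c) :
    IsGroupInverse c a :=
  ⟨h.1.symm, h.2.2, h.2.1⟩

/-- If every nonempty set of `R`-classes inside a `D`-class has a greatest element, then left
multiplication by a subgroup element `a` moves elements `p ≤_R a` down in the `R`-order. -/
theorem IsGroupInverse.leR_mul [Semigroup Q]
    (hwo : ∀ q : Q, ∀ T ⊆ DClassRClasses q, T.Nonempty → ∃ m ∈ T, ∀ x ∈ T, x ≤ m)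
    {a c p : Q} (hac : IsGroupInverse a c) (hp : c * (a * p) = p) : leR (a * p) p := by
  have hfix : ∀ n : ℕ, c * (a * (a * ·)^[n] p) = (a * ·)^[n] p := by
    intro n
    cases n with
    | zero => exact hp
    | succ n =>
      rw [Function.iterate_succ_apply', ← mul_assoc a a, ← mul_assoc c, ← mul_assoc c,
        ← hac.1, hac.2.1]
  have hL : ∀ n : ℕ, GreenL ((a * ·)^[n] p) p := by
    intro n
    induction n with
    | zero => exact ⟨Or.inl rfl, Or.inl rfl⟩
    | succ n ih =>
      rw [Function.iterate_succ_apply']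
      exact ⟨leL_trans (Or.inr ⟨a, rfl⟩) ih.1, leL_trans ih.2 (Or.inr ⟨c, (hfix n).symm⟩)⟩
  obtain ⟨_, ⟨m, rfl⟩, hmax⟩ :=
    hwo p (Set.range fun n : ℕ => RClassOf ((a * ·)^[n] p))
      (by
        rintro _ ⟨n, rfl⟩
        exact ⟨_, rfl, p, hL n, leR_refl _, leR_refl _⟩)
      (Set.range_nonempty _)
  have hcancel : ∀ n : ℕ, leR ((a * ·)^[n + 1] p) ((a * ·)^[n] p) → leR (a * p) p := by
    intro n
    induction n with
    | zero => exact id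
    | succ n ih =>
      intro h
      apply ih
      have := leR_mul_left c h
      rwa [Function.iterate_succ_apply' _ (n + 1), hfix, Function.iterate_succ_apply' _ n,
        hfix, ← Function.iterate_succ_apply' (a * ·) n] at this
  exact hcancel m (hmax _ ⟨m + 1, rfl⟩)

theorem IsGroupInverse.greenR_mul [Semigroup Q]
    (hwo : ∀ q : Q, ∀ T ⊆ DClassRClasses q, T.Nonempty → ∃ m ∈ T, ∀ x ∈ T, x ≤ m)
    {a c p : Q} (hac : IsGroupInverse a c) (hp : c * (a * p) = p) : GreenR (a * p) p := by
  have hp' : a * (c * p) = p := by rw [← mul_assoc, hac.1, mul_assoc, hp]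
  refine ⟨hac.leR_mul hwo hp, ?_⟩
  have h := leR_mul_left a (hac.symm.leR_mul hwo hp')
  rwa [hp'] at h

theorem GreenR.trans [Semigroup Q] {a b c : Q} (h1 : GreenR a b) (h2 : GreenR b c) :
    GreenR a c :=
  ⟨leR_trans h1.1 h2.1, leR_trans h2.2 h1.2⟩

/-- A weak left order meets every `H`-class, provided that every nonempty set of `R`-classes
inside a `D`-class has a greatest element. -/
theorem IsWeakLeftOrder.veryLarge [Semigroup Q] {S : Subsemigroup Q}
    (hS : IsWeakLeftOrder (S : Set Q))
    (hwo : ∀ q : Q, ∀ T ⊆ DClassRClasses q, T.Nonempty → ∃ m ∈ T, ∀ x ∈ T, x ≤ m) :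
    VeryLarge (S : Set Q) := by
  intro q
  obtain ⟨a, ha, b, hb, c, hac, rfl⟩ := hS q
  have h1 : c * (a * (c * b)) = c * b := by rw [← mul_assoc, ← mul_assoc, hac.2.2]
  have h2 : c * (a * (a * (c * b))) = a * (c * b) := by
    simp only [← mul_assoc]
    rw [← hac.1, hac.2.1]
  have h3 : a * (a * (c * b)) = a * b := by
    rw [← mul_assoc a c, hac.1, ← mul_assoc, ← mul_assoc, hac.2.1]
  refine ⟨a * b, S.mul_mem ha hb, ?_⟩
  rw [← h3]
  refine ⟨⟨Or.inr ⟨a * a, (mul_assoc _ _ _).symm⟩, Or.inr ⟨c * c, ?_⟩⟩, ?_⟩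
  · rw [mul_assoc, h2, h1]
  · exact (hac.greenR_mul hwo h2).trans (hac.greenR_mul hwo h1)

/-- An element `H`-related to an idempotent `e` has an inverse in the group `H`-class of `e`. -/
theorem GreenH.exists_inverse [Semigroup Q] {x e : Q} (h : GreenH x e) (he : e * e = e) :
    e * x = x ∧ x * e = x ∧ ∃ z, x * z = e ∧ z * x = e ∧ e * z = z := by
  obtain ⟨⟨hl, hl'⟩, hr, hr'⟩ := h
  have hex : e * x = x := by
    rcases hr with rfl | ⟨w, rfl⟩
    · exact he
    · rw [← mul_assoc, he]
  have hxe : x * e = x := by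
    rcases hl with rfl | ⟨w, rfl⟩
    · exact he
    · rw [mul_assoc, he]
  obtain ⟨u, hu⟩ : ∃ u, x * u = e := by
    rcases hr' with rfl | ⟨u, hu⟩
    · exact ⟨_, he⟩
    · exact ⟨u, hu.symm⟩
  obtain ⟨v, hv⟩ : ∃ v, v * x = e := by
    rcases hl' with rfl | ⟨v, hv⟩
    · exact ⟨_, he⟩
    · exact ⟨v, hv.symm⟩
  have huv : e * u = v * e := by rw [← hu, ← mul_assoc v, hv, hu]
  refine ⟨hex, hxe, e * u, ?_, ?_, ?_⟩
  · rw [← mul_assoc, hxe, hu]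
  · rw [huv, mul_assoc, hex, hv]
  · rw [← mul_assoc, he]

/-- Corollary 3.12: let `S` be a weak left order in a regular semigroup `Q` such that in
every `D`-class of `Q` the `R`-classes form a chain under the order induced by `≤_R`
which is inversely well ordered (every non-empty subset has a greatest element).  Then
`S` is a straight weak left order in `Q`. -/
theorem straight_of_inversely_well_ordered {Q : Type u} [Semigroup Q] (hQ : Regular Q)
    (S : Subsemigroup Q) (hS : IsWeakLeftOrder (S : Set Q))
    (hchain : ∀ q : Q, ∀ x ∈ DClassRClasses q, ∀ y ∈ DClassRClasses q, x ≤ y ∨ y ≤ x)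
    (hwo : ∀ q : Q, ∀ T ⊆ DClassRClasses q, T.Nonempty → ∃ m ∈ T, ∀ x ∈ T, x ≤ m) :
    IsStraightWeakLeftOrder (S : Set Q) := by
  intro q
  obtain ⟨a, ha, b, hb, c, hac, hq⟩ := hS q
  obtain ⟨r, hr⟩ := hQ q
  have hfq : a * (c * q) = q := by
    rw [hq, ← mul_assoc, ← mul_assoc, hac.1, hac.2.2]
  obtain ⟨e, he⟩ : ∃ e, e = q * r * (a * c) := ⟨_, rfl⟩
  have heq : e * q = q := by rw [he, mul_assoc, mul_assoc a c q, hfq, hr]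
  have hee : e * e = e := by
    nth_rewrite 2 [he]
    rw [← mul_assoc e, ← mul_assoc e, heq, ← he]
  have hff : a * c * (a * c) = a * c := by rw [← mul_assoc, hac.2.1]
  have hef : e * (a * c) = e := by rw [he, mul_assoc, hff]
  have hfe : a * (c * e) = e := by
    rw [he, ← mul_assoc c, ← mul_assoc c, ← mul_assoc a, ← mul_assoc a, hfq]
  have hfe' : c * (a * e) = e := by rw [← mul_assoc, ← hac.1, mul_assoc, hfe]
  have hece : e * (c * e) = c * e := by
    rcases hac.symm.leR_mul hwo hfe with h | ⟨w, h⟩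
    · rw [h, hee]
    · rw [h, ← mul_assoc, hee]
  have heae : e * (a * e) = a * e := by
    rcases hac.leR_mul hwo hfe' with h | ⟨w, h⟩
    · rw [h, hee]
    · rw [h, ← mul_assoc, hee]
  obtain ⟨x, hx, hxH⟩ := hS.veryLarge hwo e
  obtain ⟨hex, hxe, z, hxz, hzx, hez⟩ := hxH.exists_inverse hee
  have hxf : x * (a * c) = x := by rw [← hxe, mul_assoc, hef]
  have hxaq : x * a * q = x * b := by
    rw [hq, mul_assoc, ← mul_assoc a, ← mul_assoc, hxf]
  obtain ⟨i, hi⟩ : ∃ i, i = c * e * a := ⟨_, rfl⟩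
  have hie : i * e = e := by rw [hi, mul_assoc, mul_assoc, heae, hfe']
  have hei : e * i = i := by rw [hi, ← mul_assoc, hece]
  have hyi : x * a * i = x * a := by
    rw [hi, ← mul_assoc, ← mul_assoc, mul_assoc x a c, hxf, hxe]
  have hiy : i * (x * a) = x * a := by
    rw [← mul_assoc, ← hex, ← mul_assoc, hie]
  have hl : c * z * (x * a) = i := by
    rw [mul_assoc, ← mul_assoc z, hzx, ← mul_assoc, ← hi]
  have hyr : x * a * (c * z) = e := by
    rw [← mul_assoc, mul_assoc x, hxf, hxz]
  have hicz : i * (c * z) = c * z := by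
    rw [hi, ← mul_assoc, mul_assoc (c * e), mul_assoc c, hef, mul_assoc, hez]
  have hh1 : x * a * (c * z * i) = i := by rw [← mul_assoc, hyr, hei]
  have hh2 : c * z * i * (x * a) = i := by rw [mul_assoc, hiy, hl]
  refine ⟨x * a, S.mul_mem hx ha, x * b, S.mul_mem hx hb, ⟨c * z * i, ⟨?_, ?_, ?_⟩, ?_⟩, ?_, ?_⟩
  · rw [hh1, hh2]
  · rw [hh1, hiy]
  · rw [hh2, ← mul_assoc, hicz]
  · rw [← hxaq, ← mul_assoc, hh2, ← heq, ← mul_assoc, hie]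
  · refine Or.inr ⟨r * (a * c) * i, ?_⟩
    calc x * a = x * a * (e * i) := by rw [hei, hyi]
      _ = x * a * q * (r * (a * c) * i) := by rw [he]; simp only [mul_assoc]
      _ = x * b * (r * (a * c) * i) := by rw [hxaq]
  · exact Or.inr ⟨q, hxaq.symm⟩
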